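/- The origin 0 ∈ ℂ³ is a critical point of each of the polynomials f = (x² + y² + z²)³ + (x³ + y³ + z³)² + z⁷ and g = g₆ + z⁷, and it is an isolated critical point: there exists ε > 0 such that the only point p ∈ ℂ³ with ‖p‖ < ε at which all three partial derivatives of f vanish is p = 0, and likewise for g. -/

import Mathlib

open MvPolynomial

/-- The singular sextic `g₆ ∈ ℂ[x,y,z]` of Oka (variables `x = X 0`, `y = X 1`, `z = X 2`). -/
noncomputable def g6 : MvPolynomial (Fin 3) ℂ :=
  X 0 ^ 6 + C 3 * X 0 ^ 5 * X 2 - C (9/4) * X 0 ^ 4 * X 2 ^ 2 - C 4 * X 0 ^ 4 * X 1 * X 2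
  - X 0 ^ 4 * X 1 ^ 2 - C (3/2) * X 0 ^ 3 * X 2 ^ 3 + C (63/16) * X 0 ^ 2 * X 2 ^ 4
  + C 10 * X 0 ^ 2 * X 1 * X 2 ^ 3 + C (47/6) * X 0 ^ 2 * X 1 ^ 2 * X 2 ^ 2
  + C (8/3) * X 0 ^ 2 * X 1 ^ 3 * X 2 + C (1/3) * X 0 ^ 2 * X 1 ^ 4
  + C (51/16) * X 0 * X 2 ^ 5 + C 8 * X 0 * X 1 * X 2 ^ 4 + C (22/3) * X 0 * X 1 ^ 2 * X 2 ^ 3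
  + C (8/3) * X 0 * X 1 ^ 3 * X 2 ^ 2 + C (1/3) * X 0 * X 1 ^ 4 * X 2
  - C (215/64) * X 2 ^ 6 - C (41/4) * X 1 * X 2 ^ 5 - C (571/48) * X 1 ^ 2 * X 2 ^ 4
  - C (190/27) * X 1 ^ 3 * X 2 ^ 3 - C (85/36) * X 1 ^ 4 * X 2 ^ 2 - C (4/9) * X 1 ^ 5 * X 2
  - C (1/27) * X 1 ^ 6

/-- A continuous function on `ℂ` that is nonzero at `0` does not vanish at the last coordinate of
any sufficiently small point of `ℂ³`. -/
lemma exists_pos_forall_norm_lt_apply_two_ne_zero (Q : ℂ → ℂ) (hQ : Continuous Q) (h0 : Q 0 ≠ 0) :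
    ∃ ε > (0 : ℝ), ∀ p : Fin 3 → ℂ, ‖p‖ < ε → Q (p 2) ≠ 0 := by
  have hopen : IsOpen {p : Fin 3 → ℂ | Q (p 2) ≠ 0} :=
    isOpen_ne_fun (hQ.comp (continuous_apply 2)) continuous_const
  obtain ⟨ε, hε, h⟩ := Metric.isOpen_iff.1 hopen 0 (by simpa using h0)
  exact ⟨ε, hε, fun p hp => h (by simpa using hp)⟩

/-- The gradient of `(x² + y² + z²)³ + (x³ + y³ + z³)² + z⁷`. -/
lemma eval_pderiv_torus_sextic (p : Fin 3 → ℂ) (f : MvPolynomial (Fin 3) ℂ)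
    (hf : f = (X 0 ^ 2 + X 1 ^ 2 + X 2 ^ 2) ^ 3 + (X 0 ^ 3 + X 1 ^ 3 + X 2 ^ 3) ^ 2 + X 2 ^ 7) :
    eval p (pderiv 0 f) = 6 * p 0 * (p 0 ^ 2 + p 1 ^ 2 + p 2 ^ 2) ^ 2
        + 6 * p 0 ^ 2 * (p 0 ^ 3 + p 1 ^ 3 + p 2 ^ 3) ∧
    eval p (pderiv 1 f) = 6 * p 1 * (p 0 ^ 2 + p 1 ^ 2 + p 2 ^ 2) ^ 2
        + 6 * p 1 ^ 2 * (p 0 ^ 3 + p 1 ^ 3 + p 2 ^ 3) ∧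
    eval p (pderiv 2 f) = 6 * p 2 * (p 0 ^ 2 + p 1 ^ 2 + p 2 ^ 2) ^ 2
        + 6 * p 2 ^ 2 * (p 0 ^ 3 + p 1 ^ 3 + p 2 ^ 3) + 7 * p 2 ^ 6 := by
  subst hf
  refine ⟨?_, ?_, ?_⟩ <;> simp [pderiv_X] <;> ring

/-- The gradient of `g₆ + z⁷`. -/
lemma eval_pderiv_g6_add (p : Fin 3 → ℂ) (g : MvPolynomial (Fin 3) ℂ) (hg : g = g6 + X 2 ^ 7) :
    eval p (pderiv 0 g) =
        6 * p 0 ^ 5 + 15 * p 0 ^ 4 * p 2 - 9 * p 0 ^ 3 * p 2 ^ 2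
        - 16 * p 0 ^ 3 * p 1 * p 2 - 4 * p 0 ^ 3 * p 1 ^ 2 - 9 / 2 * p 0 ^ 2 * p 2 ^ 3
        + 63 / 8 * p 0 * p 2 ^ 4 + 20 * p 0 * p 1 * p 2 ^ 3
        + 47 / 3 * p 0 * p 1 ^ 2 * p 2 ^ 2 + 16 / 3 * p 0 * p 1 ^ 3 * p 2
        + 2 / 3 * p 0 * p 1 ^ 4 + 51 / 16 * p 2 ^ 5 + 8 * p 1 * p 2 ^ 4
        + 22 / 3 * p 1 ^ 2 * p 2 ^ 3 + 8 / 3 * p 1 ^ 3 * p 2 ^ 2 + 1 / 3 * p 1 ^ 4 * p 2 ∧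
    eval p (pderiv 1 g) =
        -4 * p 0 ^ 4 * p 2 - 2 * p 0 ^ 4 * p 1 + 10 * p 0 ^ 2 * p 2 ^ 3
        + 47 / 3 * p 0 ^ 2 * p 1 * p 2 ^ 2 + 8 * p 0 ^ 2 * p 1 ^ 2 * p 2
        + 4 / 3 * p 0 ^ 2 * p 1 ^ 3 + 8 * p 0 * p 2 ^ 4 + 44 / 3 * p 0 * p 1 * p 2 ^ 3
        + 8 * p 0 * p 1 ^ 2 * p 2 ^ 2 + 4 / 3 * p 0 * p 1 ^ 3 * p 2 - 41 / 4 * p 2 ^ 5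
        - 571 / 24 * p 1 * p 2 ^ 4 - 190 / 9 * p 1 ^ 2 * p 2 ^ 3
        - 85 / 9 * p 1 ^ 3 * p 2 ^ 2 - 20 / 9 * p 1 ^ 4 * p 2 - 2 / 9 * p 1 ^ 5 ∧
    eval p (pderiv 2 g) =
        3 * p 0 ^ 5 - 9 / 2 * p 0 ^ 4 * p 2 - 4 * p 0 ^ 4 * p 1
        - 9 / 2 * p 0 ^ 3 * p 2 ^ 2 + 63 / 4 * p 0 ^ 2 * p 2 ^ 3
        + 30 * p 0 ^ 2 * p 1 * p 2 ^ 2 + 47 / 3 * p 0 ^ 2 * p 1 ^ 2 * p 2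
        + 8 / 3 * p 0 ^ 2 * p 1 ^ 3 + 255 / 16 * p 0 * p 2 ^ 4 + 32 * p 0 * p 1 * p 2 ^ 3
        + 22 * p 0 * p 1 ^ 2 * p 2 ^ 2 + 16 / 3 * p 0 * p 1 ^ 3 * p 2
        + 1 / 3 * p 0 * p 1 ^ 4 - 645 / 32 * p 2 ^ 5 - 205 / 4 * p 1 * p 2 ^ 4
        - 571 / 12 * p 1 ^ 2 * p 2 ^ 3 - 190 / 9 * p 1 ^ 3 * p 2 ^ 2
        - 85 / 18 * p 1 ^ 4 * p 2 - 4 / 9 * p 1 ^ 5 + 7 * p 2 ^ 6 := by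
  subst hg
  refine ⟨?_, ?_, ?_⟩ <;> simp [g6, pderiv_X] <;> ring

/-- Vanishing of the gradient of `(x² + y² + z²)³ + (x³ + y³ + z³)² + z⁷` at a point off the plane
`z = 0`, in the coordinates `u = x / z`, `v = y / z`, forces `z` to be a root of a polynomial with
nonzero constant term. -/
lemma torus_sextic_critical_value (u v z : ℂ) (hz : z ≠ 0)
    (hu : u * ((u ^ 2 + v ^ 2 + 1) ^ 2 + u * (u ^ 3 + v ^ 3 + 1)) = 0)
    (hv : v * ((u ^ 2 + v ^ 2 + 1) ^ 2 + v * (u ^ 3 + v ^ 3 + 1)) = 0)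
    (hw : 6 * ((u ^ 2 + v ^ 2 + 1) ^ 2 + (u ^ 3 + v ^ 3 + 1)) + 7 * z = 0) :
    (7 * z + 12) * (1728 / 2401 - 24 / 343 * z + 508 / 441 * z ^ 2 + 46 / 21 * z ^ 3 + z ^ 4)
      * (1944 / 2401 - 1161 / 686 * z + 15 / 7 * z ^ 3 + z ^ 4) = 0 := by
  have quartic (t : ℂ) (ht : 1 + t + 2 * t ^ 2 + 2 * t ^ 4 = 0)
      (hzt : z = -9 / 7 + 3 / 7 * t - 6 / 7 * t ^ 2 - 6 / 7 * t ^ 3) :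
      1944 / 2401 - 1161 / 686 * z + 15 / 7 * z ^ 3 + z ^ 4 = 0 := by
    rw [hzt]
    linear_combination (5589 / 4802 - 2349 / 2401 * t - 486 / 343 * t ^ 2 + 3726 / 2401 * t ^ 3
      + 972 / 2401 * t ^ 4 - 1944 / 2401 * t ^ 5 + 1944 / 2401 * t ^ 6 + 2592 / 2401 * t ^ 7
      + 648 / 2401 * t ^ 8) * ht
  rcases mul_eq_zero.1 hu with rfl | hu
  · rcases mul_eq_zero.1 hv with rfl | hv
    · have : 7 * z + 12 = 0 := by linear_combination hw
      simp [this]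
    · rw [quartic v (by linear_combination hv) (by linear_combination (hw - 3 * hv) / 7)]
      simp
  rcases mul_eq_zero.1 hv with rfl | hv
  · rw [quartic u (by linear_combination hu) (by linear_combination (hw - 3 * hu) / 7)]
    simp
  have huv : (u - v) * (u ^ 3 + v ^ 3 + 1) = 0 := by linear_combination hu - hv
  rcases mul_eq_zero.1 huv with h | h
  · obtain rfl : u = v := sub_eq_zero.1 h
    have hzu : z = -8 / 7 + 4 / 7 * u - 8 / 7 * u ^ 2 - 12 / 7 * u ^ 3 := by
      linear_combination (hw - 4 * hu) / 7
    have : 1728 / 2401 - 24 / 343 * z + 508 / 441 * z ^ 2 + 46 / 21 * z ^ 3 + z ^ 4 = 0 := by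
      rw [hzu]
      linear_combination (16000 / 21609 - 17120 / 21609 * u - 34208 / 21609 * u ^ 2
        + 6080 / 2401 * u ^ 3 + 8384 / 7203 * u ^ 4 - 7040 / 2401 * u ^ 5 + 2304 / 2401 * u ^ 6
        + 9216 / 2401 * u ^ 7 + 3456 / 2401 * u ^ 8) * hu
    rw [this]
    simp
  · exact absurd (by linear_combination (hw - 6 * hu - 6 * (1 - u) * h) / 7) hz

/-- Vanishing of the gradient of `g₆ + z⁷` at a point off the plane `z = 0`, in the coordinates
`u = x / z`, `v = y / z`, forces `z` to be a root of a polynomial with nonzero constant term.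
Here `g₆(u, v, 1) = -τ³ + p(u) (3 τ + 3 u² + 3 u - 5/4)` with `p(u) = (u + 1) (2 u - 1)² / 2`. -/
lemma g6_critical_value (u v z τ p : ℂ) (hz : z ≠ 0)
    (hτ : τ = (v ^ 2 + 4 * v) / 3 - u ^ 2 - u + 7 / 4) (hp : p = (u + 1) * (2 * u - 1) ^ 2 / 2)
    (hu : 3 / 2 * (2 * u - 1) * (2 * u + 1) * (3 * τ + 5 * u ^ 2 + 4 * u - 9 / 4)
      + 3 * (p - τ ^ 2) * (-2 * u - 1) = 0)
    (hv : (v + 2) * (p - τ ^ 2) = 0)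
    (hw : 6 * (-τ ^ 3 + p * (3 * τ + 3 * u ^ 2 + 3 * u - 5 / 4)) + 7 * z = 0) :
    (7 * z - 24) * (63 * z - 16) *
      (-864 / 26796875 - 3596688 / 478515625 * z - 523872 / 68359375 * z ^ 2 + z ^ 3) = 0 := by
  rcases mul_eq_zero.1 hv with hv | hpτ
  · obtain rfl : v = -2 := eq_neg_of_add_eq_zero_left hv
    have hτ' : τ = -(u ^ 2 + u - 5 / 12) := by linear_combination hτ
    have hw' : 6 * (u ^ 2 + u - 5 / 12) ^ 3 + 7 * z = 0 := by
      rw [hτ', hp] at hw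
      linear_combination hw
    have hu' : (2 * u + 1) * (u ^ 2 + u - 5 / 12) ^ 2 = 0 := by
      rw [hτ', hp] at hu
      linear_combination hu / 3
    rcases mul_eq_zero.1 hu' with h | h
    · have hu2 : u = -1 / 2 := by linear_combination h / 2
      have : 63 * z - 16 = 0 := by
        rw [hu2] at hw'
        linear_combination 9 * hw'
      simp [this]
    · exact absurd (by linear_combination (hw' - 6 * (u ^ 2 + u - 5 / 12) * h) / 7) hz
  · have hu' : (2 * u - 1) * ((2 * u + 1) * (3 * τ + 5 * u ^ 2 + 4 * u - 9 / 4)) = 0 := by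
      linear_combination 2 / 3 * hu + 2 * (2 * u + 1) * hpτ
    have hhalf (h : u = -1 / 2) : 7 * z - 24 = 0 := by
      subst h
      have hp1 : p = 1 := by rw [hp]; norm_num
      subst hp1
      have h1 : (τ - 1) * (τ + 1) = 0 := by linear_combination -hpτ
      rcases mul_eq_zero.1 h1 with h1 | h1
      · obtain rfl : τ = 1 := sub_eq_zero.1 h1
        exact absurd (by linear_combination hw / 7) hz
      · obtain rfl : τ = -1 := eq_neg_of_add_eq_zero_left h1
        linear_combination hw
    rcases mul_eq_zero.1 hu' with h | h
    · have hu2 : u = 1 / 2 := by linear_combination h / 2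
      have hp0 : p = 0 := by rw [hp, hu2]; norm_num
      subst hp0
      exact absurd (by linear_combination (hw - 6 * τ * hpτ) / 7) hz
    rcases mul_eq_zero.1 h with h | h
    · rw [hhalf (by linear_combination h / 2)]
      simp
    have hτ' : τ = -(5 * u ^ 2 + 4 * u - 9 / 4) / 3 := by linear_combination h / 3
    have hq : (2 * u + 1) * (200 * u ^ 3 + 76 * u ^ 2 - 90 * u + 9) = 0 := by
      rw [hτ', hp] at hpτ
      linear_combination -144 * hpτ
    rcases mul_eq_zero.1 hq with h | hq
    · rw [hhalf (by linear_combination h / 2)]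
      simp
    have hzu : z = -20481 / 218750 + 1726 / 21875 * u + 33358 / 109375 * u ^ 2 := by
      rw [hτ', hp] at hw
      linear_combination hw / 7 + (10369 / 3500000 - 1859 / 630000 * u
        - 289 / 12600 * u ^ 2 - 5 / 252 * u ^ 3) * hq
    have : -864 / 26796875 - 3596688 / 478515625 * z - 523872 / 68359375 * z ^ 2 + z ^ 3 = 0 := by
      rw [hzu]
      linear_combination (-157327362117801 / 6542205810546875000
        - 41372094728159 / 654220581054687500 * u + 91899471505309 / 1635551452636718750 * u ^ 2
        + 4639915014839 / 32711029052734375 * u ^ 3) * hq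
    rw [this]
    simp

/-- The origin is a critical point of each of `f = (x²+y²+z²)³ + (x³+y³+z³)² + z⁷` and
`g = g₆ + z⁷`, and it is an isolated critical point of each. -/
theorem origin_isolated_critical_point_of_f_and_g
    (f g : MvPolynomial (Fin 3) ℂ)
    (hf : f = (X 0 ^ 2 + X 1 ^ 2 + X 2 ^ 2) ^ 3 + (X 0 ^ 3 + X 1 ^ 3 + X 2 ^ 3) ^ 2 + X 2 ^ 7)
    (hg : g = g6 + X 2 ^ 7) :
    ((∀ i, eval (0 : Fin 3 → ℂ) (pderiv i f) = 0) ∧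
      ∃ ε > (0 : ℝ), ∀ p : Fin 3 → ℂ, ‖p‖ < ε → (∀ i, eval p (pderiv i f) = 0) → p = 0) ∧
    ((∀ i, eval (0 : Fin 3 → ℂ) (pderiv i g) = 0) ∧
      ∃ ε > (0 : ℝ), ∀ p : Fin 3 → ℂ, ‖p‖ < ε → (∀ i, eval p (pderiv i g) = 0) → p = 0) := by
  refine ⟨⟨?_, ?_⟩, ?_, ?_⟩
  · obtain ⟨h0, h1, h2⟩ := eval_pderiv_torus_sextic 0 f hf
    intro i
    fin_cases i
    · exact h0.trans (by simp)
    · exact h1.trans (by simp)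
    · exact h2.trans (by simp)
  · obtain ⟨ε, hε, h⟩ := exists_pos_forall_norm_lt_apply_two_ne_zero
      (fun z => (7 * z + 12)
        * (1728 / 2401 - 24 / 343 * z + 508 / 441 * z ^ 2 + 46 / 21 * z ^ 3 + z ^ 4)
        * (1944 / 2401 - 1161 / 686 * z + 15 / 7 * z ^ 3 + z ^ 4)) (by fun_prop) (by norm_num)
    refine ⟨ε, hε, fun p hp hcrit => ?_⟩
    obtain ⟨e0, e1, e2⟩ := eval_pderiv_torus_sextic p f hf
    rw [hcrit] at e0 e1 e2
    have hQ := h p hp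
    have hz : p 2 = 0 := by
      by_contra hz
      refine hQ (torus_sextic_critical_value (p 0 / p 2) (p 1 / p 2) (p 2) hz ?_ ?_ ?_)
      · field_simp
        linear_combination -e0 / 6
      · field_simp
        linear_combination -e1 / 6
      · field_simp
        refine mul_left_cancel₀ hz ?_
        linear_combination -e2
    simp only [hz] at e0 e1
    have hxy : p 0 = 0 ∧ p 1 = 0 := by
      generalize p 0 = x at *
      generalize p 1 = y at *
      have hx : x * ((x ^ 2 + y ^ 2) ^ 2 + x * (x ^ 3 + y ^ 3)) = 0 := by
        linear_combination -e0 / 6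
      have hy : y * ((x ^ 2 + y ^ 2) ^ 2 + y * (x ^ 3 + y ^ 3)) = 0 := by
        linear_combination -e1 / 6
      rcases mul_eq_zero.1 hx with rfl | hx
      · refine ⟨rfl, pow_eq_zero_iff (n := 5) (by norm_num) |>.1 ?_⟩
        linear_combination hy / 2
      rcases mul_eq_zero.1 hy with rfl | hy
      · refine ⟨pow_eq_zero_iff (n := 4) (by norm_num) |>.1 ?_, rfl⟩
        linear_combination hx / 2
      have hxy : (x - y) * (x ^ 3 + y ^ 3) = 0 := by linear_combination hx - hy
      rcases mul_eq_zero.1 hxy with h | h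
      · obtain rfl : x = y := sub_eq_zero.1 h
        have : x = 0 := pow_eq_zero_iff (n := 4) (by norm_num) |>.1 (by linear_combination hx / 6)
        exact ⟨this, this⟩
      · have h2 : x ^ 2 + y ^ 2 = 0 :=
          pow_eq_zero_iff (n := 2) (by norm_num) |>.1 (by linear_combination hx - x * h)
        have hx0 : x = 0 := pow_eq_zero_iff (n := 6) (by norm_num) |>.1 (by
          linear_combination ((x ^ 3 - y ^ 3) * h + (x ^ 4 - x ^ 2 * y ^ 2 + y ^ 4) * h2) / 2)
        subst hx0
        exact ⟨rfl, pow_eq_zero_iff (n := 2) (by norm_num) |>.1 (by linear_combination h2)⟩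
    ext i
    fin_cases i <;> simp [hxy, hz]
  · obtain ⟨h0, h1, h2⟩ := eval_pderiv_g6_add 0 g hg
    intro i
    fin_cases i
    · exact h0.trans (by simp)
    · exact h1.trans (by simp)
    · exact h2.trans (by simp)
  · obtain ⟨ε, hε, h⟩ := exists_pos_forall_norm_lt_apply_two_ne_zero
      (fun z => (7 * z - 24) * (63 * z - 16)
        * (-864 / 26796875 - 3596688 / 478515625 * z - 523872 / 68359375 * z ^ 2 + z ^ 3))
      (by fun_prop) (by norm_num)
    refine ⟨ε, hε, fun p hp hcrit => ?_⟩
    obtain ⟨e0, e1, e2⟩ := eval_pderiv_g6_add p g hg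
    rw [hcrit] at e0 e1 e2
    have hQ := h p hp
    have hz : p 2 = 0 := by
      by_contra hz
      obtain ⟨u, hu⟩ : ∃ u, p 0 = u * p 2 := ⟨p 0 / p 2, by field_simp⟩
      obtain ⟨v, hv⟩ : ∃ v, p 1 = v * p 2 := ⟨p 1 / p 2, by field_simp⟩
      rw [hu, hv] at e0 e1 e2
      refine hQ (g6_critical_value u v (p 2) _ _ hz rfl rfl ?_ ?_ ?_)
      · refine mul_left_cancel₀ (pow_ne_zero 5 hz) ?_
        linear_combination -e0
      · refine mul_left_cancel₀ (pow_ne_zero 5 hz) ?_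
        linear_combination -e1 / 2
      · refine mul_left_cancel₀ (pow_ne_zero 5 hz) ?_
        linear_combination -(u * e0 + v * e1 + e2)
    simp only [hz] at e0 e1 e2
    have hxy : p 0 = 0 ∧ p 1 = 0 := by
      generalize p 0 = x at *
      generalize p 1 = y at *
      have hx : x * (x ^ 2 - y ^ 2 / 3) ^ 2 = 0 := by linear_combination -e0 / 6
      have hy : y * (x ^ 2 - y ^ 2 / 3) ^ 2 = 0 := by linear_combination e1 / 2
      by_cases h : x ^ 2 - y ^ 2 / 3 = 0
      · have hxy : x * y ^ 4 = 0 := by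
          linear_combination -3 / 2 * e2
            - 3 / 2 * (3 * x ^ 3 - 4 * x ^ 2 * y + x * y ^ 2 + 4 / 3 * y ^ 3) * h
        rcases mul_eq_zero.1 hxy with rfl | hy0
        · exact ⟨rfl, pow_eq_zero_iff (n := 2) (by norm_num) |>.1 (by linear_combination -3 * h)⟩
        · obtain rfl : y = 0 := pow_eq_zero_iff (n := 4) (by norm_num) |>.1 hy0
          exact ⟨pow_eq_zero_iff (n := 2) (by norm_num) |>.1 (by linear_combination h), rfl⟩
      · have h2 := pow_ne_zero 2 h
        exact ⟨(mul_eq_zero.1 hx).resolve_right h2, (mul_eq_zero.1 hy).resolve_right h2⟩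
    ext i
    fin_cases i <;> simp [hxy, hz]
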